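/- arXiv:1811.11281 — 2 statements merged into one kernel-verified Lean document; each statement's English description precedes it below -/
import Mathlib

section
/- (Minimality of the functional 𝒢.) Let C ⊆ ℝ² be a bounded measurable set with 0 < vol(C) < ∞ and 0 < Per(C) < ∞, set λ_C = Per(C)/vol(C), and suppose C is calibrable: there exists a measurable ξ : ℝ² → ℝ² with ‖ξ(x)‖ ≤ 1 for almost every x and with distributional divergence λ_C·χ_C. Define 𝒢_{λ_C}(D) = Per(D) − λ_C·vol(D). Then 𝒢_{λ_C}(C) = 0 and for every bounded measurable set D ⊆ C of finite variational perimeter, 𝒢_{λ_C}(D) ≥ 𝒢_{λ_C}(C), i.e. Per(D) − λ_C·vol(D) ≥ 0. -/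
open MeasureTheory RealInnerProductSpace
open scoped ENNReal

/-- The Euclidean plane. -/
abbrev Plane := EuclideanSpace ℝ (Fin 2)

/-- The divergence of a planar vector field: the trace of its Fréchet
derivative. -/
noncomputable def divg (F : Plane → Plane) (x : Plane) : ℝ :=
  LinearMap.trace ℝ Plane (fderiv ℝ F x).toLinearMap

/-- The values `∫_E div ξ` over smooth compactly supported fields `ξ` with
`‖ξ‖ ≤ 1`, whose supremum is the variational perimeter of `E`. -/
def perimVals (E : Set Plane) : Set ℝ≥0∞ :=
  {r | ∃ ξ : Plane → Plane, ContDiff ℝ (⊤ : ℕ∞) ξ ∧ HasCompactSupport ξ ∧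
    (∀ x, ‖ξ x‖ ≤ 1) ∧ r = ENNReal.ofReal (∫ x in E, divg ξ x)}

/-- The variational perimeter of a set `E ⊆ ℝ²`. -/
noncomputable def Per (E : Set Plane) : ℝ≥0∞ := sSup (perimVals E)

/-- `η` has distributional divergence `λ · χ_C`:
`∫ ⟨η, ∇φ⟩ = -λ ∫_C φ` for every smooth compactly supported `φ`. -/
def HasDistribDiv (η : Plane → Plane) (lam : ℝ) (C : Set Plane) : Prop :=
  ∀ φ : Plane → ℝ, ContDiff ℝ (⊤ : ℕ∞) φ → HasCompactSupport φ →
    ∫ x : Plane, ⟪η x, gradient φ x⟫ = -lam * ∫ x in C, φ x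

open Filter Topology ContinuousLinearMap
open scoped Convolution

/-- Convolving with a normalised bump function does not increase an a.e. bound on the norm. -/
lemma norm_normed_convolution_le {E : Type*} [NormedAddCommGroup E] [NormedSpace ℝ E]
    (ρ : ContDiffBump (0 : Plane)) {g : Plane → E} {M : ℝ} (hg : ∀ᵐ x, ‖g x‖ ≤ M) (x : Plane) :
    ‖(ρ.normed volume ⋆[lsmul ℝ ℝ, volume] g) x‖ ≤ M := by
  have hint : Integrable (fun t ↦ ρ.normed volume t * M) volume := ρ.integrable_normed.mul_const M
  have hg' : ∀ᵐ t : Plane, ‖g (x - t)‖ ≤ M :=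
    (Measure.measurePreserving_sub_left volume x).quasiMeasurePreserving.ae hg
  calc ‖(ρ.normed volume ⋆[lsmul ℝ ℝ, volume] g) x‖
      ≤ ∫ t, ρ.normed volume t * M := by
        refine norm_integral_le_of_norm_le hint ?_
        filter_upwards [hg'] with t ht
        rw [lsmul_apply, norm_smul, Real.norm_of_nonneg (ρ.nonneg_normed t)]
        exact mul_le_mul_of_nonneg_left ht (ρ.nonneg_normed t)
    _ = M := by rw [integral_mul_const, ρ.integral_normed, one_mul]

/-- The divergence of a mollified vector field, with the derivative put on the kernel. -/
lemma divg_convolution {ρ : Plane → ℝ} (hρc : HasCompactSupport ρ) (hρ : ContDiff ℝ 1 ρ)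
    {ξ : Plane → Plane} (hξ : LocallyIntegrable ξ volume) (x : Plane) :
    divg (ρ ⋆[lsmul ℝ ℝ, volume] ξ) x = ∫ t, fderiv ℝ ρ t (ξ (x - t)) := by
  let T : (Plane →L[ℝ] Plane) →L[ℝ] ℝ :=
    LinearMap.toContinuousLinearMap (LinearMap.trace ℝ Plane ∘ₗ ContinuousLinearMap.coeLM ℝ)
  have hint := (hρc.fderiv ℝ).convolutionExists_left
    ((lsmul ℝ ℝ : ℝ →L[ℝ] Plane →L[ℝ] Plane).precompL Plane)
    (hρ.continuous_fderiv one_ne_zero) hξ x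
  have hT : divg (ρ ⋆[lsmul ℝ ℝ, volume] ξ) x = T (fderiv ℝ (ρ ⋆[lsmul ℝ ℝ, volume] ξ) x) := rfl
  rw [hT, (hρc.hasFDerivAt_convolution_left (lsmul ℝ ℝ) hρ hξ x).fderiv, convolution,
    ← T.integral_comp_comm hint]
  refine integral_congr_ae (Eventually.of_forall fun t ↦ ?_)
  exact LinearMap.trace_smulRight (fderiv ℝ ρ t).toLinearMap (ξ (x - t))

/-- Mollification commutes with the distributional divergence. -/
lemma HasDistribDiv.divg_convolution {ξ : Plane → Plane} {lam : ℝ} {C : Set Plane}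
    (h : HasDistribDiv ξ lam C) (hC : MeasurableSet C) (hξ : LocallyIntegrable ξ volume)
    {ρ : Plane → ℝ} (hρc : HasCompactSupport ρ) (hρ : ContDiff ℝ (⊤ : ℕ∞) ρ) (x : Plane) :
    divg (ρ ⋆[lsmul ℝ ℝ, volume] ξ) x =
      lam * (ρ ⋆[lsmul ℝ ℝ, volume] C.indicator (fun _ ↦ (1 : ℝ))) x := by
  have hρ1 : ContDiff ℝ 1 ρ := hρ.of_le (by exact_mod_cast le_top)
  have hgrad (y : Plane) : ⟪ξ y, gradient (fun y ↦ ρ (x - y)) y⟫ = -fderiv ℝ ρ (x - y) (ξ y) := by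
    have hd : HasFDerivAt (fun y ↦ ρ (x - y)) (-fderiv ℝ ρ (x - y)) y := by
      simpa using! ((hρ1.differentiable one_ne_zero) (x - y)).hasFDerivAt.comp y
        ((hasFDerivAt_id y).const_sub x)
    rw [inner_gradient_right, hd.fderiv]
    simp
  have hdiv := h (fun y ↦ ρ (x - y)) (hρ.comp (contDiff_const.sub contDiff_id))
    (hρc.comp_homeomorph (Homeomorph.subLeft x))
  simp_rw [hgrad, integral_neg, neg_mul, neg_inj] at hdiv
  rw [_root_.divg_convolution hρc hρ1 hξ,
    ← integral_sub_left_eq_self (fun t ↦ fderiv ℝ ρ t (ξ (x - t))) volume x]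
  simp_rw [sub_sub_cancel]
  rw [hdiv, convolution_eq_swap, ← integral_indicator hC]
  congr 1
  refine integral_congr_ae (Eventually.of_forall fun t ↦ ?_)
  by_cases ht : t ∈ C <;> simp [ht]

/-- On a bounded set, the fields in the definition of the perimeter need not have compact
support. -/
lemma setIntegral_divg_le_Per {D : Set Plane} (hD : MeasurableSet D) (hb : Bornology.IsBounded D)
    (hP : Per D ≠ ⊤) {η : Plane → Plane} (hη : ContDiff ℝ (⊤ : ℕ∞) η) (hη1 : ∀ x, ‖η x‖ ≤ 1) :
    ∫ x in D, divg η x ≤ (Per D).toReal := by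
  obtain ⟨R, hR, hDR⟩ := hb.subset_ball_lt 0 0
  let ψ : ContDiffBump (0 : Plane) := ⟨R, R + 1, hR, lt_add_one R⟩
  have hcongr : ∫ x in D, divg η x = ∫ x in D, divg (fun y ↦ ψ y • η y) x := by
    refine setIntegral_congr_fun hD fun x hx ↦ ?_
    have heq : (fun y ↦ ψ y • η y) =ᶠ[𝓝 x] η := by
      filter_upwards [ψ.eventuallyEq_one_of_mem_ball (hDR hx)] with y hy
      simp [hy]
    simp only [divg, heq.fderiv_eq]
  have hle : ENNReal.ofReal (∫ x in D, divg η x) ≤ Per D := by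
    refine le_sSup ⟨fun y ↦ ψ y • η y, ψ.contDiff.smul hη, ψ.hasCompactSupport.smul_right,
      fun x ↦ ?_, by rw [hcongr]⟩
    rw [norm_smul, Real.norm_of_nonneg ψ.nonneg]
    exact mul_le_one₀ ψ.le_one (norm_nonneg _) (hη1 x)
  exact (ENNReal.ofReal_le_iff_le_toReal hP).1 hle

/-- A field bounded by one with distributional divergence `lam · χ_C` bounds the perimeter of the
subsets of `C` from below. -/
lemma HasDistribDiv.mul_volume_le_Per {ξ : Plane → Plane} {lam : ℝ} {C : Set Plane}
    (h : HasDistribDiv ξ lam C) (hC : MeasurableSet C) (hξm : Measurable ξ)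
    (hξ1 : ∀ᵐ x : Plane, ‖ξ x‖ ≤ 1) {D : Set Plane} (hDC : D ⊆ C) (hD : MeasurableSet D)
    (hb : Bornology.IsBounded D) (hP : Per D ≠ ⊤) :
    lam * (volume D).toReal ≤ (Per D).toReal := by
  have hξ : LocallyIntegrable ξ volume :=
    (memLp_top_of_bound hξm.aestronglyMeasurable 1 hξ1).locallyIntegrable le_top
  let g : Plane → ℝ := C.indicator fun _ ↦ 1
  have hg1 : ∀ᵐ x, ‖g x‖ ≤ 1 := Eventually.of_forall fun x ↦ by
    by_cases hx : x ∈ C <;> simp [g, hx]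
  have hg : LocallyIntegrable g volume :=
    (memLp_top_of_bound (measurable_const.indicator hC).aestronglyMeasurable 1
      hg1).locallyIntegrable le_top
  let ρ : ℕ → ContDiffBump (0 : Plane) := fun n ↦
    ⟨1 / ((n : ℝ) + 1), 2 * (1 / ((n : ℝ) + 1)), by positivity,
      lt_mul_of_one_lt_left (by positivity) one_lt_two⟩
  have hρ0 : Tendsto (fun n ↦ (ρ n).rOut) atTop (𝓝 0) := by
    have := (tendsto_one_div_add_atTop_nhds_zero_nat (𝕜 := ℝ)).const_mul (2 : ℝ)
    rwa [mul_zero] at this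
  have hlim := ContDiffBump.ae_convolution_tendsto_right_of_locallyIntegrable (μ := volume)
    (K := 2) hρ0 (Eventually.of_forall fun n ↦ le_rfl) hg
  have hfin : IsFiniteMeasure (volume.restrict D) := ⟨by simpa using hb.measure_lt_top⟩
  have hint : Tendsto (fun n ↦ ∫ x in D, ((ρ n).normed volume ⋆[lsmul ℝ ℝ, volume] g) x) atTop
      (𝓝 (∫ x in D, g x)) := by
    refine tendsto_integral_of_dominated_convergence (fun _ ↦ 1) (fun n ↦ ?_)
      (integrable_const 1) (fun n ↦ Eventually.of_forall fun x ↦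
        norm_normed_convolution_le (ρ n) hg1 x) (ae_restrict_of_ae hlim)
    exact ((ρ n).hasCompactSupport_normed.continuous_convolution_left _
      (ρ n).continuous_normed hg).aestronglyMeasurable
  have hgD : ∫ x in D, g x = (volume D).toReal := by
    rw [setIntegral_congr_fun hD (g := fun _ ↦ (1 : ℝ)) fun x hx ↦
      Set.indicator_of_mem (hDC hx) _]
    simp [Measure.real]
  rw [← hgD]
  refine le_of_tendsto' (hint.const_mul lam) fun n ↦ ?_
  rw [← integral_const_mul]
  simp_rw [g, ← h.divg_convolution hC hξ (ρ n).hasCompactSupport_normed (ρ n).contDiff_normed]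
  exact setIntegral_divg_le_Per hD hb hP
    ((ρ n).hasCompactSupport_normed.contDiff_convolution_left _ (ρ n).contDiff_normed hξ)
    (norm_normed_convolution_le (ρ n) hξ1)

/-- Minimality of `𝒢_{λ_C}(D) = Per D - λ_C vol D`: for a calibrable set `C`,
`𝒢_{λ_C}(C) = 0` and `𝒢_{λ_C}(D) ≥ 𝒢_{λ_C}(C)` for every bounded measurable
`D ⊆ C` of finite perimeter. -/
theorem G_functional_minimality
    (C : Set Plane) (hC : MeasurableSet C) (hCbdd : Bornology.IsBounded C)
    (hv0 : volume C ≠ 0) (hvT : volume C ≠ ⊤)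
    (hp0 : Per C ≠ 0) (hpT : Per C ≠ ⊤)
    (ξ : Plane → Plane) (hξm : Measurable ξ)
    (hξ1 : ∀ᵐ x : Plane, ‖ξ x‖ ≤ 1)
    (hdiv : HasDistribDiv ξ ((Per C).toReal / (volume C).toReal) C) :
    (Per C).toReal - (Per C).toReal / (volume C).toReal * (volume C).toReal = 0 ∧
      ∀ D : Set Plane, D ⊆ C → MeasurableSet D → Bornology.IsBounded D →
        Per D ≠ ⊤ →
        (Per C).toReal - (Per C).toReal / (volume C).toReal * (volume C).toReal ≤
          (Per D).toReal - (Per C).toReal / (volume C).toReal * (volume D).toReal := by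
  have h0 : (Per C).toReal - (Per C).toReal / (volume C).toReal * (volume C).toReal = 0 := by
    rw [div_mul_cancel₀ _ (ENNReal.toReal_ne_zero.2 ⟨hv0, hvT⟩), sub_self]
  refine ⟨h0, fun D hDC hD hb hP ↦ ?_⟩
  rw [h0, sub_nonneg]
  exact hdiv.mul_volume_le_Per hC hξm hξ1 hDC hD hb hP
end

section
/- (Non-Convexity Condition, part 1.) Let a ∈ (0,1], let A : ℝ² → L(ℝ², ℝ²) satisfy that A(x) is self-adjoint with operator norm ‖A(x)‖ ≤ 1 for every x, let C ⊆ ℝ² be a bounded measurable set with 0 < vol(C) < ∞ and 0 < Per(C) < ∞, set λ^A_C = a·Per(C)/vol(C), and suppose C is A-calibrable: there exists a measurable ξ : ℝ² → ℝ² with ‖ξ(x)‖ ≤ 1 for almost every x such that the field x ↦ A(x)(ξ(x)) has distributional divergence λ^A_C·χ_C. Then for every bounded measurable set D ⊆ ℝ² with C ⊆ D, a·Per(C) ≤ Per(D). In particular C need not minimize perimeter among its supersets, i.e. C may be non-convex to the extent permitted by a. -/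
open MeasureTheory RealInnerProductSpace
open scoped ENNReal

open Filter Topology Convolution

/-- Smooth cutoff functions equal to `1` on a prescribed bounded set exist. -/
lemma exists_contDiffBump_eq_one_on {S : Set Plane} (hS : Bornology.IsBounded S) :
    ∃ χ : ContDiffBump (0 : Plane), S ⊆ Metric.ball 0 χ.rIn := by
  obtain ⟨R, hR, h⟩ := hS.subset_ball_lt 0 (0 : Plane)
  exact ⟨⟨R, R + 1, hR, by linarith⟩, h⟩

namespace HasDistribDiv

variable {η : Plane → Plane} {lam : ℝ} {C : Set Plane}

/-- If `λ ≠ 0` and `C` is not null, the defining identity forces the pairing of `η` with every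
test gradient to be integrable. -/
lemma integrable_inner_gradient (h : HasDistribDiv η lam C) (hlam : lam ≠ 0)
    (hC : MeasurableSet C) (hCb : Bornology.IsBounded C) (hv : volume C ≠ 0)
    {φ : Plane → ℝ} (hφ : ContDiff ℝ (⊤ : ℕ∞) φ) (hφc : HasCompactSupport φ) :
    Integrable (fun x => ⟪η x, gradient φ x⟫) := by
  have key : ∀ ψ : Plane → ℝ, ContDiff ℝ (⊤ : ℕ∞) ψ → HasCompactSupport ψ →
      ∫ x in C, ψ x ≠ 0 → Integrable (fun x => ⟪η x, gradient ψ x⟫) := by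
    intro ψ hψ hψc h0
    by_contra hcon
    have := h ψ hψ hψc
    rw [integral_undef hcon] at this
    exact mul_ne_zero (neg_ne_zero.mpr hlam) h0 this.symm
  by_cases h0 : ∫ x in C, φ x = 0
  · obtain ⟨χ, hχ⟩ := exists_contDiffBump_eq_one_on hCb
    have hχd : ContDiff ℝ (⊤ : ℕ∞) (χ : Plane → ℝ) := χ.contDiff
    have hχ1 : ∫ x in C, χ x = volume.real C := by
      rw [setIntegral_congr_fun hC (g := fun _ => (1 : ℝ))
        (fun x hx => χ.one_of_mem_closedBall (Metric.ball_subset_closedBall (hχ hx)))]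
      simp
    have hχ0 : ∫ x in C, χ x ≠ 0 := by
      rw [hχ1]
      exact (ENNReal.toReal_pos hv hCb.measure_lt_top.ne).ne'
    have hsum : ∫ x in C, (φ + χ) x ≠ 0 := by
      simp only [Pi.add_apply]
      rw [integral_add (hφ.continuous.integrable_of_hasCompactSupport hφc).integrableOn
        χ.integrable.integrableOn, h0, zero_add]
      exact hχ0
    have hdiff := (key (φ + χ) (hφ.add hχd) (hφc.add χ.hasCompactSupport) hsum).sub
      (key χ hχd χ.hasCompactSupport hχ0)
    refine hdiff.congr (Eventually.of_forall fun x => ?_)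
    have hadd := fderiv_add (hφ.differentiable (by simp) x) (hχd.differentiable (by simp) x)
    simp [inner_gradient_right, hadd]
  · exact key φ hφ hφc h0

/-- Under the same assumptions, `η` is almost everywhere strongly measurable. -/
lemma aestronglyMeasurable (h : HasDistribDiv η lam C) (hlam : lam ≠ 0)
    (hC : MeasurableSet C) (hCb : Bornology.IsBounded C) (hv : volume C ≠ 0) :
    AEStronglyMeasurable η volume := by
  have hcoord : ∀ i : Fin 2, AEStronglyMeasurable (fun x => η x i) volume := by
    intro i
    choose χ hχ using fun n : ℕ =>
      exists_contDiffBump_eq_one_on (Metric.isBounded_ball (x := (0 : Plane)) (r := (n : ℝ)))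
    let p : Plane →L[ℝ] ℝ := EuclideanSpace.proj i
    have hmeas : ∀ n, AEStronglyMeasurable
        (fun x => ⟪η x, gradient (fun y => χ n y * p y) x⟫) volume := fun n =>
      (h.integrable_inner_gradient hlam hC hCb hv ((χ n).contDiff.mul p.contDiff)
        (χ n).hasCompactSupport.mul_right).aestronglyMeasurable
    refine aestronglyMeasurable_of_tendsto_ae atTop hmeas (Eventually.of_forall fun x => ?_)
    obtain ⟨N, hN⟩ := exists_nat_gt ‖x‖
    refine tendsto_const_nhds.congr' ((eventually_ge_atTop N).mono fun n hn => ?_)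
    have hx : x ∈ Metric.ball (0 : Plane) (χ n).rIn := by
      apply hχ n
      rw [mem_ball_zero_iff]
      exact hN.trans_le (by exact_mod_cast hn)
    have heq : (fun y => χ n y * p y) =ᶠ[𝓝 x] p := by
      filter_upwards [Metric.isOpen_ball.mem_nhds hx] with y hy
      rw [(χ n).one_of_mem_closedBall (Metric.ball_subset_closedBall hy), one_mul]
    beta_reduce
    rw [inner_gradient_right, heq.fderiv_eq, p.fderiv]
    rfl
  have : η = fun x => ∑ i : Fin 2, η x i • EuclideanSpace.single i (1 : ℝ) := by
    funext x
    ext j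
    fin_cases j <;> simp
  rw [this]
  exact Finset.aestronglyMeasurable_fun_sum _ fun i _ => (hcoord i).smul_const _

/-- Mollifying a field of distributional divergence `λ χ_C` gives a field whose divergence is
`λ` times the mollification of `χ_C`. -/
lemma divg_convolution_s17 (h : HasDistribDiv η lam C) (hη : LocallyIntegrable η volume)
    (hC : MeasurableSet C) {ρ : Plane → ℝ} (hρ : ContDiff ℝ (⊤ : ℕ∞) ρ)
    (hρc : HasCompactSupport ρ) (x : Plane) :
    divg (ρ ⋆[ContinuousLinearMap.lsmul ℝ ℝ, volume] η) x =
      lam * (ρ ⋆[ContinuousLinearMap.lsmul ℝ ℝ, volume] C.indicator (fun _ => (1 : ℝ))) x := by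
  have hρ1 : ContDiff ℝ 1 ρ := hρ.of_le (by exact_mod_cast le_top)
  let L := (ContinuousLinearMap.lsmul ℝ ℝ : ℝ →L[ℝ] Plane →L[ℝ] Plane)
  let T : (Plane →L[ℝ] Plane) →L[ℝ] ℝ := LinearMap.toContinuousLinearMap
    ((LinearMap.trace ℝ Plane).comp (ContinuousLinearMap.coeLM ℝ))
  have hT : ∀ B : Plane →L[ℝ] Plane, T B = LinearMap.trace ℝ Plane B.toLinearMap := fun _ => rfl
  have hD : Continuous (fderiv ℝ ρ) := hρ1.continuous_fderiv (by simp)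
  have hint : Integrable (fun t => (L.precompL Plane) (fderiv ℝ ρ t) (η (x - t))) volume :=
    (hρc.fderiv ℝ).convolutionExists_left (L.precompL Plane) hD hη x
  have htr : ∀ (B : Plane →L[ℝ] ℝ) (v : Plane), T ((L.precompL Plane) B v) = B v := by
    intro B v
    rw [hT]
    exact LinearMap.trace_smulRight (B : Plane →ₗ[ℝ] ℝ) v
  have hdiv : divg (ρ ⋆[L, volume] η) x = ∫ t, fderiv ℝ ρ (x - t) (η t) := by
    rw [divg, (hρc.hasFDerivAt_convolution_left L hρ1 hη x).fderiv, ← hT, convolution_def,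
      ← T.integral_comp_comm hint, ← integral_sub_left_eq_self _ volume x]
    simp [htr]
  have htest := h (fun t => ρ (x - t)) (hρ.comp (contDiff_const.sub contDiff_id))
    (hρc.comp_homeomorph (Homeomorph.subLeft x))
  have hgrad : ∀ t, ⟪η t, gradient (fun t => ρ (x - t)) t⟫ = - fderiv ℝ ρ (x - t) (η t) := by
    intro t
    have hd : HasFDerivAt (fun t => ρ (x - t))
        ((fderiv ℝ ρ (x - t)).comp (-ContinuousLinearMap.id ℝ Plane)) t :=
      (hρ1.differentiable (by simp) (x - t)).hasFDerivAt.comp t ((hasFDerivAt_id t).const_sub x)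
    simp [inner_gradient_right, hd.fderiv]
  simp only [hgrad, integral_neg] at htest
  have hconv : (ρ ⋆[ContinuousLinearMap.lsmul ℝ ℝ, volume] C.indicator (fun _ => (1 : ℝ))) x =
      ∫ t in C, ρ (x - t) := by
    rw [convolution_lsmul_swap, ← integral_indicator hC]
    congr 1
    funext t
    by_cases ht : t ∈ C <;> simp [ht]
  rw [hdiv, hconv]
  linarith

end HasDistribDiv

/-- Mollification does not increase an almost everywhere bound. -/
lemma ContDiffBump.norm_convolution_normed_le {F : Type*} [NormedAddCommGroup F]
    [NormedSpace ℝ F] (χ : ContDiffBump (0 : Plane)) {g : Plane → F}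
    {M : ℝ} (hg : ∀ᵐ x, ‖g x‖ ≤ M) (x : Plane) :
    ‖(χ.normed volume ⋆[ContinuousLinearMap.lsmul ℝ ℝ, volume] g) x‖ ≤ M := by
  rw [convolution_lsmul_swap]
  calc ‖∫ t, χ.normed volume (x - t) • g t‖
      ≤ ∫ t, χ.normed volume (x - t) * M := by
        refine norm_integral_le_of_norm_le ((χ.integrable_normed.comp_sub_left x).mul_const M) ?_
        filter_upwards [hg] with t ht
        rw [norm_smul, Real.norm_of_nonneg (χ.nonneg_normed _)]
        exact mul_le_mul_of_nonneg_left ht (χ.nonneg_normed _)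
    _ = M := by
        rw [integral_mul_const, integral_sub_left_eq_self (χ.normed volume) volume x,
          χ.integral_normed, one_mul]

/-- On a bounded set `D`, the integral of the divergence of any smooth field bounded by `1` is
at most the perimeter of `D`, without any support condition. -/
lemma ofReal_setIntegral_divg_le_Per {D : Set Plane} (hD : MeasurableSet D)
    (hDb : Bornology.IsBounded D) {F : Plane → Plane} (hF : ContDiff ℝ (⊤ : ℕ∞) F)
    (hF1 : ∀ x, ‖F x‖ ≤ 1) : ENNReal.ofReal (∫ x in D, divg F x) ≤ Per D := by
  obtain ⟨χ, hχ⟩ := exists_contDiffBump_eq_one_on hDb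
  refine le_sSup ⟨fun x => χ x • F x, χ.contDiff.smul hF, χ.hasCompactSupport.smul_right,
    fun x => ?_, ?_⟩
  · rw [norm_smul, Real.norm_of_nonneg χ.nonneg]
    exact mul_le_one₀ χ.le_one (norm_nonneg _) (hF1 x)
  · congr 1
    refine setIntegral_congr_fun hD fun x hx => ?_
    have heq : (fun y => χ y • F y) =ᶠ[𝓝 x] F := by
      filter_upwards [Metric.isOpen_ball.mem_nhds (hχ hx)] with y hy
      rw [χ.one_of_mem_closedBall (Metric.ball_subset_closedBall hy), one_smul]
    simp only [divg, heq.fderiv_eq]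

/-- A field bounded by `1` with distributional divergence `λ χ_C` yields `λ vol(C) ≤ Per(D)` for
every bounded superset `D` of `C`. -/
lemma HasDistribDiv.ofReal_mul_volume_le_Per {η : Plane → Plane} {lam : ℝ} {C D : Set Plane}
    (h : HasDistribDiv η lam C) (hηm : AEStronglyMeasurable η volume)
    (hη1 : ∀ᵐ x, ‖η x‖ ≤ 1) (hC : MeasurableSet C) (hCD : C ⊆ D) (hD : MeasurableSet D)
    (hDb : Bornology.IsBounded D) : ENNReal.ofReal (lam * volume.real C) ≤ Per D := by
  have hη : LocallyIntegrable η volume :=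
    (memLp_top_of_bound hηm 1 hη1).locallyIntegrable le_top
  let f : Plane → ℝ := C.indicator fun _ => 1
  have hf1 : ∀ x, ‖f x‖ ≤ 1 := fun x =>
    (norm_indicator_le_norm_self _ _).trans (by simp)
  have hf : LocallyIntegrable f volume :=
    (memLp_top_of_bound (aestronglyMeasurable_const.indicator hC) 1
      (Eventually.of_forall hf1)).locallyIntegrable le_top
  let χ : ℕ → ContDiffBump (0 : Plane) := fun n =>
    ⟨1 / ((n : ℝ) + 1), 2 * (1 / ((n : ℝ) + 1)), by positivity,
      lt_two_mul_self (by positivity)⟩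
  have hsmooth : ∀ n, ContDiff ℝ (⊤ : ℕ∞) ((χ n).normed volume) := fun n =>
    (χ n).contDiff_normed
  let g : ℕ → Plane → ℝ := fun n =>
    (χ n).normed volume ⋆[ContinuousLinearMap.lsmul ℝ ℝ, volume] f
  have hg_lim : ∀ᵐ x, Tendsto (fun n => g n x) atTop (𝓝 (f x)) := by
    refine ContDiffBump.ae_convolution_tendsto_right_of_locallyIntegrable (K := 2) ?_
      (Eventually.of_forall fun n => le_rfl) hf
    simpa [χ] using (tendsto_one_div_add_atTop_nhds_zero_nat (𝕜 := ℝ)).const_mul 2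
  have hg_int : Tendsto (fun n => ∫ x in D, g n x) atTop (𝓝 (∫ x in D, f x)) := by
    refine tendsto_integral_of_dominated_convergence (fun _ => (1 : ℝ)) (fun n => ?_)
      (integrableOn_const hDb.measure_lt_top.ne) (fun n => Eventually.of_forall fun x =>
        (χ n).norm_convolution_normed_le (Eventually.of_forall hf1) x)
      (ae_restrict_of_ae hg_lim)
    exact ((χ n).hasCompactSupport_normed.continuous_convolution_left _
      (χ n).continuous_normed hf).aestronglyMeasurable
  have hfD : ∫ x in D, f x = volume.real C := by
    rw [setIntegral_indicator hC, Set.inter_eq_self_of_subset_right hCD]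
    simp
  rw [hfD] at hg_int
  refine le_of_tendsto (ENNReal.tendsto_ofReal (hg_int.const_mul lam))
    (Eventually.of_forall fun n => ?_)
  have hle := ofReal_setIntegral_divg_le_Per hD hDb
    ((χ n).hasCompactSupport_normed.contDiff_convolution_left
      (ContinuousLinearMap.lsmul ℝ ℝ) (hsmooth n) hη)
    (fun x => (χ n).norm_convolution_normed_le hη1 x)
  simp only [h.divg_convolution_s17 hη hC (hsmooth n) (χ n).hasCompactSupport_normed,
    integral_const_mul] at hle
  exact hle

/-- Non-convexity condition, part 1: if `C` is `A`-calibrable with anisotropy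
parameter `a ∈ (0,1]`, then `a · Per C ≤ Per D` for every bounded measurable
superset `D` of `C` — so `C` may be non-convex to the extent permitted by `a`. -/
theorem A_calibrable_perimeter_bound_among_supersets
    (a : ℝ) (ha : a ∈ Set.Ioc (0 : ℝ) 1)
    (A : Plane → (Plane →L[ℝ] Plane))
    (hAsa : ∀ x : Plane, ∀ y z : Plane, ⟪A x y, z⟫ = ⟪y, A x z⟫)
    (hAnorm : ∀ x : Plane, ‖A x‖ ≤ 1)
    (C : Set Plane) (hC : MeasurableSet C) (hCbdd : Bornology.IsBounded C)
    (hv0 : volume C ≠ 0) (hvT : volume C ≠ ⊤)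
    (hp0 : Per C ≠ 0) (hpT : Per C ≠ ⊤)
    (ξ : Plane → Plane) (hξm : Measurable ξ)
    (hξ1 : ∀ᵐ x : Plane, ‖ξ x‖ ≤ 1)
    (hdiv : HasDistribDiv (fun x => A x (ξ x))
      (a * (Per C).toReal / (volume C).toReal) C) :
    ∀ D : Set Plane, C ⊆ D → MeasurableSet D → Bornology.IsBounded D →
      ENNReal.ofReal a * Per C ≤ Per D := by
  intro D hCD hD hDb
  have hVpos : 0 < (volume C).toReal := ENNReal.toReal_pos hv0 hvT
  have hPpos : 0 < (Per C).toReal := ENNReal.toReal_pos hp0 hpT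
  have hlam : a * (Per C).toReal / (volume C).toReal ≠ 0 :=
    (div_pos (mul_pos ha.1 hPpos) hVpos).ne'
  have hη1 : ∀ᵐ x, ‖A x (ξ x)‖ ≤ 1 := by
    filter_upwards [hξ1] with x hx
    exact ((A x).le_of_opNorm_le_of_le (hAnorm x) hx).trans_eq (one_mul 1)
  have hle := hdiv.ofReal_mul_volume_le_Per
    (hdiv.aestronglyMeasurable hlam hC hCbdd hv0) hη1 hC hCD hD hDb
  rwa [Measure.real, div_mul_cancel₀ _ hVpos.ne', ENNReal.ofReal_mul ha.1.le,
    ENNReal.ofReal_toReal hpT] at hle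
end
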